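/- Let (X, B, μ) be a probability space with a measure-preserving action of a countable sofic group G and Σ a sofic approximation sequence. If S and T are two generating σ-subalgebras of B, then h_{Σ,μ}(S) = h_{Σ,μ}(T). In particular, for any generating σ-subalgebra S, the sofic measure entropy h_{Σ,μ}(X,G) := h_{Σ,μ}(B) equals h_{Σ,μ}(S). -/

import Mathlib

open MeasureTheory Filter Finset Pointwise

section Defs

variable {G : Type*} [Group G] [DecidableEq G]
variable {X : Type*} [MeasurableSpace X] [MulAction G X]

/-- A finite measurable partition of `X`, indexed by `Fin n`. -/
def IsFinPartition {n : ℕ} (P : Fin n → Set X) : Prop :=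
  (∀ i, MeasurableSet (P i)) ∧ Pairwise (Function.onFun Disjoint P) ∧ (⋃ i, P i) = Set.univ

/-- `A` refines `P` via the index map `r` (each atom of `A` is contained in an atom of `P`). -/
def PartRefines {X : Type*} {m n : ℕ} (A : Fin m → Set X) (P : Fin n → Set X)
    (r : Fin m → Fin n) : Prop :=
  ∀ i, A i ⊆ P (r i)

/-- The uniform probability measure `ζ` of a subset of `{1,…,d}`. -/
noncomputable def unif {d : ℕ} (S : Set (Fin d)) : ℝ := S.ncard / d

/-- The cell `⋂_{s∈F} s A_{f(s)}` of the join partition `α_F`. -/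
def cellF {m : ℕ} (A : Fin m → Set X) (F : Finset G) (f : {s // s ∈ F} → Fin m) : Set X :=
  ⋂ s : {s // s ∈ F}, (s : G) • A (f s)

/-- Given the values `φ f` of a homomorphism on the cells of `α_F` (indexed by functions
`G → Fin m`, depending only on the restriction to `F`), the image `φ(s A_i)`. -/
def sBlock {m d : ℕ} (φ : (G → Fin m) → Set (Fin d)) (s : G) (i : Fin m) : Set (Fin d) :=
  ⋃ f ∈ {f : G → Fin m | f s = i}, φ f

/-- The image under `φ` of the cell of `α_F` determined by `f : F → Fin m`. -/
def cellBlock {m d : ℕ} (φ : (G → Fin m) → Set (Fin d)) (F : Finset G)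
    (f : {s // s ∈ F} → Fin m) : Set (Fin d) :=
  ⋃ g ∈ {g : G → Fin m | ∀ s : {s // s ∈ F}, g (s : G) = f s}, φ g

/-- `φ ∈ Hom_μ(α, F, δ, σ)`: `φ` is (the atom data of) a Boolean algebra homomorphism
`Σ(α_F) → P({1,…,d})` which is approximately equivariant and approximately
measure-preserving to within `δ`. -/
def IsHom (μ : Measure X) {m : ℕ} (A : Fin m → Set X) (F : Finset G) (δ : ℝ)
    {d : ℕ} (σ : G → Equiv.Perm (Fin d)) (φ : (G → Fin m) → Set (Fin d)) : Prop :=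
  (∀ f g : G → Fin m, (∀ s ∈ F, f s = g s) → φ f = φ g) ∧
  (∀ f g : G → Fin m, (∃ s ∈ F, f s ≠ g s) → Disjoint (φ f) (φ g)) ∧
  (⋃ f, φ f) = Set.univ ∧
  (∀ s ∈ F, ∑ i : Fin m,
      unif (symmDiff ((σ s) '' sBlock φ 1 i) (sBlock φ s i)) < δ) ∧
  (∑ f : {s // s ∈ F} → Fin m,
      |unif (cellBlock φ F f) - (μ (cellF A F f)).toReal| < δ)

/-- The restriction of `φ` to the coarser partition `ξ`, along the refinement map `r`. -/
def restrictHom {m n d : ℕ} (r : Fin m → Fin n) (φ : (G → Fin m) → Set (Fin d)) :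
    Fin n → Set (Fin d) :=
  fun j => ⋃ f ∈ {f : G → Fin m | r (f 1) = j}, φ f

/-- `|Hom_μ(α,F,δ,σ)|_ξ`: the number of restrictions to `ξ` of elements of
`Hom_μ(α,F,δ,σ)`. -/
noncomputable def homCount (μ : Measure X) {m n : ℕ} (A : Fin m → Set X) (r : Fin m → Fin n)
    (F : Finset G) (δ : ℝ) {d : ℕ} (σ : G → Equiv.Perm (Fin d)) : ℕ :=
  (restrictHom r '' {φ | IsHom μ A F δ σ φ}).ncard

/-- `h_{Σ,μ}^ξ(α,F,δ)`. -/
noncomputable def hFδ (μ : Measure X) {m n : ℕ} (A : Fin m → Set X) (r : Fin m → Fin n)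
    (F : Finset G) (δ : ℝ) (d : ℕ → ℕ) (σ : ∀ i, G → Equiv.Perm (Fin (d i))) : ℝ :=
  limsup (fun i => Real.log (homCount μ A r F δ (σ i)) / d i) atTop

/-- `h_{Σ,μ}^ξ(α) = inf_F inf_δ h_{Σ,μ}^ξ(α,F,δ)`, the infimum over nonempty finite
`F ⊆ G` (containing the identity, so that `α ⊆ Σ(α_F)`) and `δ > 0`. -/
noncomputable def hPartLoc (μ : Measure X) {m n : ℕ} (A : Fin m → Set X) (r : Fin m → Fin n)
    (d : ℕ → ℕ) (σ : ∀ i, G → Equiv.Perm (Fin (d i))) : ℝ :=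
  sInf { x | ∃ (F : Finset G) (δ : ℝ), (1 : G) ∈ F ∧ 0 < δ ∧ x = hFδ μ A r F δ d σ }

/-- `h_{Σ,μ}^ξ(S)`: the infimum over finite partitions `α ⊆ S` refining `ξ`. -/
noncomputable def hXi (μ : Measure X) (S : Set (Set X)) {n : ℕ} (P : Fin n → Set X)
    (d : ℕ → ℕ) (σ : ∀ i, G → Equiv.Perm (Fin (d i))) : ℝ :=
  sInf { x | ∃ (m : ℕ) (A : Fin m → Set X) (r : Fin m → Fin n),
    IsFinPartition A ∧ (∀ i, A i ∈ S) ∧ PartRefines A P r ∧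
    x = hPartLoc μ A r d σ }

/-- `h_{Σ,μ}(S)`: the supremum over finite partitions `ξ ⊆ S` of `h_{Σ,μ}^ξ(S)`. -/
noncomputable def hAlg (μ : Measure X) (S : Set (Set X))
    (d : ℕ → ℕ) (σ : ∀ i, G → Equiv.Perm (Fin (d i))) : ℝ :=
  sSup { x | ∃ (n : ℕ) (P : Fin n → Set X),
    IsFinPartition P ∧ (∀ j, P j ∈ S) ∧ x = hXi μ S P d σ }

/-- `Σ = (σ i : G → Sym(d i))` is a sofic approximation sequence: asymptotically
multiplicative and free. -/
def IsSoficApprox {G : Type*} [Group G] (d : ℕ → ℕ)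
    (σ : ∀ i, G → Equiv.Perm (Fin (d i))) : Prop :=
  (∀ s t : G, Tendsto (fun i =>
      (({k : Fin (d i) | σ i (s * t) k = σ i s (σ i t k)}.ncard : ℝ)) / d i)
      atTop (nhds 1)) ∧
  (∀ s t : G, s ≠ t → Tendsto (fun i =>
      (({k : Fin (d i) | σ i s k ≠ σ i t k}.ncard : ℝ)) / d i)
      atTop (nhds 1))

/-- The Shannon entropy `H_μ(P)` of a finite partition. -/
noncomputable def shannonEnt (μ : Measure X) {n : ℕ} (P : Fin n → Set X) : ℝ :=
  -∑ i, (μ (P i)).toReal * Real.log (μ (P i)).toReal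

end Defs

/-- The `G`-invariant σ-algebra generated by a σ-subalgebra `S`: the σ-algebra generated
by all translates `g • A` of sets `A ∈ S`. -/
def invGen (G : Type*) [Group G] {X : Type*} [MulAction G X]
    (S : MeasurableSpace X) : MeasurableSpace X :=
  MeasurableSpace.generateFrom
    {C | ∃ (g : G) (A : Set X), MeasurableSet[S] A ∧ C = g • A}

/-- A σ-subalgebra `S ≤ B` is generating if the smallest `G`-invariant σ-subalgebra
containing `S` is `B` up to `μ`-null sets. -/
def IsGenerating (G : Type*) [Group G] {X : Type*} [mX : MeasurableSpace X] [MulAction G X]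
    (μ : Measure X) (S : MeasurableSpace X) : Prop :=
  S ≤ mX ∧ ∀ B : Set X, MeasurableSet[mX] B →
    ∃ B' : Set X, MeasurableSet[invGen G S] B' ∧ μ (symmDiff B B') = 0


section Helpers

/-- The normalized counting measure on `Fin d`. -/
noncomputable def unifM (d : ℕ) : Measure (Fin d) := ENNReal.ofReal (1 / d) • Measure.count

instance instFiniteUnifM (d : ℕ) : IsFiniteMeasure (unifM d) := by
  unfold unifM
  constructor
  rw [Measure.smul_apply, smul_eq_mul]
  exact ENNReal.mul_lt_top ENNReal.ofReal_lt_top (measure_lt_top _ _)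

lemma unif_eq {d : ℕ} (S : Set (Fin d)) : unif S = (unifM d).real S := by
  unfold unif unifM
  rw [measureReal_def, Measure.smul_apply, smul_eq_mul, ENNReal.toReal_mul,
    ENNReal.toReal_ofReal (by positivity), Measure.count_apply_finite S S.toFinite,
    Set.ncard_eq_toFinset_card S S.toFinite]
  simp
  ring

lemma abs_real_sub_le {Y : Type*} [MeasurableSpace Y] (ν : Measure Y) [IsFiniteMeasure ν]
    {A B D : Set Y} (h : ∀ x, x ∉ D → (x ∈ A ↔ x ∈ B)) :
    |ν.real A - ν.real B| ≤ ν.real D := by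
  have h1 : ν.real A ≤ ν.real B + ν.real D := by
    refine (measureReal_mono ?_).trans (measureReal_union_le B D)
    intro x hx
    by_cases hD : x ∈ D
    · exact Or.inr hD
    · exact Or.inl ((h x hD).1 hx)
  have h2 : ν.real B ≤ ν.real A + ν.real D := by
    refine (measureReal_mono ?_).trans (measureReal_union_le A D)
    intro x hx
    by_cases hD : x ∈ D
    · exact Or.inr hD
    · exact Or.inl ((h x hD).2 hx)
  rw [abs_le]; constructor <;> linarith

/-- `ν(h ∈ E)` as a sum over cells. -/
lemma real_preimage_sum {Y ι : Type*} [MeasurableSpace Y] (ν : Measure Y) [IsFiniteMeasure ν]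
    [Fintype ι] (h : Y → ι) (hm : ∀ i, MeasurableSet {y | h y = i}) (I : Finset ι) :
    ν.real {y | h y ∈ I} = ∑ i ∈ I, ν.real {y | h y = i} := by
  have : {y | h y ∈ I} = ⋃ i ∈ I, {y | h y = i} := by
    ext y; simp
  rw [this, measureReal_biUnion_finset]
  · intro i _ j _ hij
    rw [Function.onFun, Set.disjoint_left]
    intro y hy hy'
    exact hij (hy.symm.trans hy')
  · intro i _; exact hm i

variable {G : Type*} [Group G] [DecidableEq G]
variable {X : Type*} [mX : MeasurableSpace X] [MulAction G X]

/-- The itinerary of `x` with respect to the labelling `l`. -/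
def nmX (G : Type*) [Group G] {X : Type*} [MulAction G X] {ι : Type*} (l : X → ι) (x : X) :
    G → ι := fun s => l (s⁻¹ • x)

/-- The itinerary of `k ∈ {1,…,d}` with respect to the labelling `a`. -/
def nmD {G : Type*} {d : ℕ} {ι : Type*} (σ : G → Equiv.Perm (Fin d)) (a : Fin d → ι) (k : Fin d) :
    G → ι := fun s => a ((σ s).symm k)

/-- Sets of itineraries depending only on coordinates in `F`. -/
def DepSet {G ι : Type*} (F : Finset G) (E : Set (G → ι)) : Prop :=
  ∀ f g : G → ι, (∀ s ∈ F, f s = g s) → (f ∈ E ↔ g ∈ E)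

/-- Label function of a partition. -/
lemma exists_label {m : ℕ} {A : Fin m → Set X} (hA : IsFinPartition A) :
    ∃ l : X → Fin m, ∀ i x, x ∈ A i ↔ l x = i := by
  have h : ∀ x, ∃ i, x ∈ A i := fun x => by
    have : x ∈ ⋃ i, A i := by rw [hA.2.2]; trivial
    simpa using this
  choose l hl using h
  refine ⟨l, fun i x => ⟨fun hx => ?_, fun h => h ▸ hl x⟩⟩
  by_contra hne
  exact Set.disjoint_left.1 (hA.2.1 hne) (hl x) hx

lemma cellF_eq {m : ℕ} {A : Fin m → Set X} {l : X → Fin m} (hl : ∀ i x, x ∈ A i ↔ l x = i)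
    (F : Finset G) (f : {s // s ∈ F} → Fin m) :
    cellF A F f = {x | ∀ s : {s // s ∈ F}, nmX G l x s = f s} := by
  ext x
  simp only [cellF, Set.mem_iInter, Set.mem_ofPred_eq, nmX, Set.mem_smul_set_iff_inv_smul_mem, hl]

lemma measurable_nmX {ι : Type*} [Finite ι] [MeasurableSpace ι] [MeasurableSingletonClass ι]
    {l : X → ι} (hl : Measurable l)
    (hact : ∀ g : G, Measurable (fun x : X => g • x)) (F : Finset G)
    (f : {s // s ∈ F} → ι) :
    MeasurableSet {x | ∀ s : {s // s ∈ F}, nmX G l x s = f s} := by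
  have : {x | ∀ s : {s // s ∈ F}, nmX G l x s = f s} =
      ⋂ s : {s // s ∈ F}, (fun x => l ((s : G)⁻¹ • x)) ⁻¹' {f s} := by
    ext x; simp [nmX]
  rw [this]
  exact MeasurableSet.iInter fun s => (hl.comp (hact _)) (measurableSet_singleton _)

lemma real_dep_sum {Y : Type*} [MeasurableSpace Y] (ν : Measure Y) [IsFiniteMeasure ν]
    {m : ℕ} (F : Finset G) (N : Y → G → Fin m)
    (hm : ∀ f : {s // s ∈ F} → Fin m, MeasurableSet {y | ∀ s : {s // s ∈ F}, N y s = f s})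
    (E : Set (G → Fin m)) (hE : DepSet F E) (I : Finset ({s // s ∈ F} → Fin m))
    (hI : ∀ f, f ∈ I ↔ ∃ g ∈ E, ∀ s : {s // s ∈ F}, f s = g s) :
    ν.real {y | N y ∈ E} =
      ∑ f ∈ I, ν.real {y | ∀ s : {s // s ∈ F}, N y s = f s} := by
  have e : ∀ f : {s // s ∈ F} → Fin m, {y | ∀ s : {s // s ∈ F}, N y s = f s} =
      {y | (fun s : {s // s ∈ F} => N y s) = f} := by
    intro f; ext y; simp [funext_iff]
  have h := real_preimage_sum ν (fun y => (fun s : {s // s ∈ F} => N y s))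
    (fun f => by rw [← e]; exact hm f) I
  simp_rw [e, ← h]
  congr 1
  ext y
  simp only [Set.mem_ofPred_eq, hI]
  constructor
  · intro h; exact ⟨_, h, fun s => rfl⟩
  · rintro ⟨g, hg, h⟩
    exact (hE _ _ fun s hs => h ⟨s, hs⟩).2 hg

/-- From homomorphisms to microstates. -/
lemma hom_to_label (μ : Measure X) [IsFiniteMeasure μ]
    (hact : ∀ g : G, Measurable (fun x : X => g • x)) {m : ℕ} {A : Fin m → Set X}
    {l : X → Fin m} (hl : ∀ i x, x ∈ A i ↔ l x = i) (hlm : Measurable l)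
    {F : Finset G} (h1 : (1 : G) ∈ F) {δ : ℝ} {d : ℕ} {σ : G → Equiv.Perm (Fin d)}
    {φ : (G → Fin m) → Set (Fin d)} (hφ : IsHom μ A F δ σ φ) :
    ∃ a : Fin d → Fin m,
      (∀ (n : ℕ) (r : Fin m → Fin n), restrictHom r φ = fun j => {k | r (a k) = j}) ∧
      ∀ E : Set (G → Fin m), DepSet F E →
        |unif {k | nmD σ a k ∈ E} - μ.real {x | nmX G l x ∈ E}| ≤ (1 + F.card) * δ := by
  classical
  obtain ⟨hinv, hdis, huniv, heq, hmeas⟩ := hφ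
  have hex : ∀ k, ∃ f, k ∈ φ f := fun k => by
    have : k ∈ ⋃ f, φ f := by rw [huniv]; trivial
    simpa using this
  choose N hN using hex
  have hmem : ∀ k f, k ∈ φ f ↔ ∀ s ∈ F, N k s = f s := by
    intro k f
    constructor
    · intro hk s hs
      by_contra hne
      exact Set.disjoint_left.1 (hdis (N k) f ⟨s, hs, hne⟩) (hN k) hk
    · intro h
      rw [← hinv _ _ h]; exact hN k
  have hblock : ∀ s ∈ F, ∀ i, sBlock φ s i = {k | N k s = i} := by
    intro s hs i
    ext k
    simp only [sBlock, Set.mem_iUnion, Set.mem_ofPred_eq, exists_prop, hmem]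
    constructor
    · rintro ⟨f, hf, h⟩; rw [h s hs, hf]
    · intro h; exact ⟨N k, h, fun _ _ => rfl⟩
  have hcell : ∀ f : {s // s ∈ F} → Fin m,
      cellBlock φ F f = {k | ∀ s : {s // s ∈ F}, N k s = f s} := by
    intro f
    ext k
    simp only [cellBlock, Set.mem_iUnion, Set.mem_ofPred_eq, exists_prop, hmem]
    constructor
    · rintro ⟨g, hg, h⟩ s; rw [h s s.2, hg]
    · intro h; exact ⟨N k, h, fun _ _ => rfl⟩
  refine ⟨fun k => N k 1, ?_, ?_⟩
  · intro n r
    ext j k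
    simp only [restrictHom, Set.mem_iUnion, Set.mem_ofPred_eq, exists_prop, hmem]
    constructor
    · rintro ⟨f, hf, h⟩; rw [h 1 h1, hf]
    · intro h; exact ⟨N k, h, fun _ _ => rfl⟩
  · intro E hE
    set a : Fin d → Fin m := fun k => N k 1 with ha
    have hbad : ∀ s ∈ F, (unifM d).real {k | a ((σ s).symm k) ≠ N k s} ≤ δ := by
      intro s hs
      refine le_trans ?_ (heq s hs).le
      simp_rw [unif_eq]
      refine (measureReal_mono ?_).trans (measureReal_iUnion_fintype_le _)
      intro k hk
      simp only [Set.mem_iUnion]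
      refine ⟨N k s, Or.inr ⟨?_, ?_⟩⟩
      · rw [hblock s hs]; rfl
      · rw [hblock 1 h1]
        rintro ⟨k', hk', rfl⟩
        apply hk
        simpa [ha] using hk'
    have hA : |(unifM d).real {k | nmD σ a k ∈ E} - (unifM d).real {k | N k ∈ E}|
        ≤ F.card * δ := by
      refine (abs_real_sub_le (unifM d) (D := ⋃ s ∈ F, {k | a ((σ s).symm k) ≠ N k s}) ?_).trans
        ((measureReal_biUnion_finset_le _ _).trans ?_)
      · intro k hk
        simp only [Set.mem_iUnion, Set.mem_ofPred_eq, not_exists, not_not] at hk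
        exact hE _ _ hk
      · calc _ ≤ ∑ s ∈ F, δ := Finset.sum_le_sum hbad
          _ = _ := by simp
    have hB : |(unifM d).real {k | N k ∈ E} - μ.real {x | nmX G l x ∈ E}| ≤ δ := by
      let I : Finset ({s // s ∈ F} → Fin m) :=
        Finset.univ.filter fun f => ∃ g ∈ E, ∀ s : {s // s ∈ F}, f s = g s
      have hI : ∀ f, f ∈ I ↔ ∃ g ∈ E, ∀ s : {s // s ∈ F}, f s = g s := by simp [I]
      rw [real_dep_sum (unifM d) F N (fun f => Set.Finite.measurableSet (Set.toFinite _)) E hE I hI,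
        real_dep_sum μ F (nmX G l) (measurable_nmX hlm hact F) E hE I hI, ← Finset.sum_sub_distrib]
      refine (Finset.abs_sum_le_sum_abs _ _).trans (le_trans ?_ hmeas.le)
      refine (Finset.sum_le_univ_sum_of_nonneg fun _ => abs_nonneg _).trans (le_of_eq ?_)
      refine Finset.sum_congr rfl fun f _ => ?_
      rw [hcell, cellF_eq hl, unif_eq, measureReal_def μ]
    rw [unif_eq]
    have := abs_sub_le ((unifM d).real {k | nmD σ a k ∈ E}) ((unifM d).real {k | N k ∈ E})
      (μ.real {x | nmX G l x ∈ E})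
    linarith

/-- From microstates to homomorphisms. -/
lemma label_to_hom (μ : Measure X) {m : ℕ} {A : Fin m → Set X}
    {l : X → Fin m} (hl : ∀ i x, x ∈ A i ↔ l x = i)
    {F : Finset G} (h1 : (1 : G) ∈ F) {δ : ℝ} {d : ℕ} {σ : G → Equiv.Perm (Fin d)}
    (b : Fin d → Fin m)
    (hσ : m * unif {k | (σ 1).symm k ≠ k} < δ)
    (hb : ∑ f : {s // s ∈ F} → Fin m,
      |unif {k | ∀ s : {s // s ∈ F}, nmD σ b k s = f s} -
        μ.real {x | ∀ s : {s // s ∈ F}, nmX G l x s = f s}| < δ) :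
    ∃ φ : (G → Fin m) → Set (Fin d), IsHom μ A F δ σ φ ∧
      ∀ (n : ℕ) (r : Fin m → Fin n),
        restrictHom r φ = fun j => {k | r (b ((σ 1).symm k)) = j} := by
  classical
  let φ : (G → Fin m) → Set (Fin d) := fun f => {k | ∀ s ∈ F, nmD σ b k s = f s}
  have hmem : ∀ k f, k ∈ φ f ↔ ∀ s ∈ F, nmD σ b k s = f s := fun _ _ => Iff.rfl
  have hblock : ∀ s ∈ F, ∀ i, sBlock φ s i = {k | nmD σ b k s = i} := by
    intro s hs i
    ext k
    simp only [sBlock, Set.mem_iUnion, Set.mem_ofPred_eq, exists_prop, hmem]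
    constructor
    · rintro ⟨f, hf, h⟩; rw [h s hs, hf]
    · intro h; exact ⟨nmD σ b k, h, fun _ _ => rfl⟩
  have hcell : ∀ f : {s // s ∈ F} → Fin m,
      cellBlock φ F f = {k | ∀ s : {s // s ∈ F}, nmD σ b k s = f s} := by
    intro f
    ext k
    simp only [cellBlock, Set.mem_iUnion, Set.mem_ofPred_eq, exists_prop, hmem]
    constructor
    · rintro ⟨g, hg, h⟩ s; rw [h s s.2, hg]
    · intro h; exact ⟨nmD σ b k, h, fun _ _ => rfl⟩
  refine ⟨φ, ⟨?_, ?_, ?_, ?_, ?_⟩, ?_⟩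
  · intro f g h
    ext k
    rw [hmem, hmem]
    constructor
    · intro hk s hs; rw [hk s hs, h s hs]
    · intro hk s hs; rw [hk s hs, h s hs]
  · rintro f g ⟨s, hs, hne⟩
    rw [Set.disjoint_left]
    intro k hk hk'
    exact hne ((hk s hs).symm.trans (hk' s hs))
  · rw [Set.eq_univ_iff_forall]
    intro k
    exact Set.mem_iUnion.2 ⟨nmD σ b k, fun _ _ => rfl⟩
  · intro s hs
    refine lt_of_le_of_lt ?_ hσ
    have : ∀ i : Fin m, unif (symmDiff ((σ s) '' sBlock φ 1 i) (sBlock φ s i)) ≤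
        unif {k | (σ 1).symm k ≠ k} := by
      intro i
      have hsub : symmDiff ((σ s) '' sBlock φ 1 i) (sBlock φ s i) ⊆
          (σ s) '' {k | (σ 1).symm k ≠ k} := by
        rw [hblock s hs, hblock 1 h1]
        intro k hk
        refine ⟨(σ s).symm k, ?_, by simp⟩
        intro hc
        rcases hk with ⟨⟨k', hk', rfl⟩, h2⟩ | ⟨h2, h3⟩
        · apply h2
          simp only [nmD, Set.mem_ofPred_eq, Equiv.symm_apply_apply] at hk' hc ⊢
          rwa [hc] at hk'
        · apply h3
          refine ⟨(σ s).symm k, ?_, by simp⟩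
          simp only [nmD, Set.mem_ofPred_eq] at h2 ⊢
          rw [hc, h2]
      unfold unif
      refine div_le_div_of_nonneg_right ?_ (by positivity)
      exact_mod_cast (Set.ncard_le_ncard hsub (Set.toFinite _)).trans
        (Set.ncard_image_le (Set.toFinite _))
    refine (Finset.sum_le_sum fun i _ => this i).trans ?_
    simp
  · convert hb using 4 with f
    · rw [hcell]
    · rw [cellF_eq hl, measureReal_def]
  · intro n r
    ext j k
    simp only [restrictHom, Set.mem_iUnion, Set.mem_ofPred_eq, exists_prop, hmem]
    constructor
    · rintro ⟨f, hf, h⟩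
      have := h 1 h1
      simp only [nmD] at this
      rw [this, hf]
    · intro h; exact ⟨nmD σ b k, h, fun _ _ => rfl⟩

/-- Hamming balls are small. -/
lemma ball_bound (n : ℕ) (κ : ℝ) (hκ : 0 < κ) : ∃ ε : ℝ, 0 < ε ∧ ∀ (d : ℕ) (v : Fin d → Fin n),
    (((Finset.univ.filter fun w : Fin d → Fin n =>
      ((Finset.univ.filter fun k => w k ≠ v k).card : ℝ) ≤ ε * d).card : ℕ) : ℝ)
      ≤ Real.exp (κ * d) := by
  set t : ℝ := min 1 (κ / (2 * (n + 1))) with ht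
  have ht0 : 0 < t := lt_min one_pos (by positivity)
  have ht1 : t ≤ 1 := min_le_left _ _
  have hnt : n * t ≤ κ / 2 := by
    have h : t ≤ κ / (2 * (n + 1)) := min_le_right _ _
    rw [le_div_iff₀ (by positivity)] at h
    nlinarith
  have hlog : Real.log t ≤ 0 := Real.log_nonpos ht0.le ht1
  set ε : ℝ := κ / (2 * (1 - Real.log t)) with hε
  have hε0 : 0 < ε := div_pos hκ (by linarith)
  have hεt : ε * (- Real.log t) ≤ κ / 2 := by
    have : ε * (2 * (1 - Real.log t)) = κ := div_mul_cancel₀ _ (by linarith)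
    nlinarith
  refine ⟨ε, hε0, fun d v => ?_⟩
  have hsum : ∑ w : Fin d → Fin n, ∏ k, (if w k = v k then (1 : ℝ) else t) ≤
      Real.exp (n * t * d) := by
    have e : ∑ w : Fin d → Fin n, ∏ k, (if w k = v k then (1 : ℝ) else t) =
        ∏ k : Fin d, ∑ j : Fin n, (if j = v k then (1 : ℝ) else t) := by
      rw [Finset.prod_univ_sum, Fintype.piFinset_univ]
    rw [e]
    calc ∏ k : Fin d, ∑ j : Fin n, (if j = v k then (1 : ℝ) else t)
        ≤ ∏ k : Fin d, Real.exp (n * t) := by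
          refine Finset.prod_le_prod (fun k _ => Finset.sum_nonneg fun j _ => ?_) fun k _ => ?_
          · split_ifs <;> positivity
          · calc ∑ j : Fin n, (if j = v k then (1 : ℝ) else t)
                ≤ ∑ j : Fin n, ((if j = v k then (1 : ℝ) else 0) + t) := by
                  refine Finset.sum_le_sum fun j _ => ?_
                  split_ifs <;> linarith
              _ = n * t + 1 := by
                  rw [Finset.sum_add_distrib]; simp; ring
              _ ≤ _ := Real.add_one_le_exp _
      _ = _ := by
          rw [Finset.prod_const, ← Real.exp_nat_mul]; simp; ring
  have hterm : ∀ w ∈ Finset.univ.filter (fun w : Fin d → Fin n =>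
      ((Finset.univ.filter fun k => w k ≠ v k).card : ℝ) ≤ ε * d),
      Real.exp (Real.log t * (ε * d)) ≤ ∏ k, (if w k = v k then (1 : ℝ) else t) := by
    intro w hw
    have hw' := (Finset.mem_filter.1 hw).2
    have : ∏ k, (if w k = v k then (1 : ℝ) else t) =
        t ^ (Finset.univ.filter fun k => w k ≠ v k).card := by
      rw [Finset.prod_ite]; simp
    rw [this, ← Real.exp_log (pow_pos ht0 _), Real.log_pow, Real.exp_le_exp]
    nlinarith
  have h1 : ((Finset.univ.filter fun w : Fin d → Fin n =>
      ((Finset.univ.filter fun k => w k ≠ v k).card : ℝ) ≤ ε * d).card : ℝ) *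
      Real.exp (Real.log t * (ε * d)) ≤ Real.exp (n * t * d) := by
    rw [← nsmul_eq_mul]
    refine (Finset.card_nsmul_le_sum _ _ _ hterm).trans (le_trans ?_ hsum)
    refine Finset.sum_le_univ_sum_of_nonneg fun w => Finset.prod_nonneg fun k _ => ?_
    split_ifs <;> positivity
  have h2 : Real.exp (n * t * d) ≤ Real.exp (κ * d) * Real.exp (Real.log t * (ε * d)) := by
    rw [← Real.exp_add, Real.exp_le_exp]
    have hd : (0 : ℝ) ≤ d := Nat.cast_nonneg _
    nlinarith
  exact le_of_mul_le_mul_right (h1.trans h2) (Real.exp_pos _)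

lemma sofic_bad (d : ℕ → ℕ) (σ : ∀ i, G → Equiv.Perm (Fin (d i)))
    (hσ : IsSoficApprox d σ) (s t : G) :
    Tendsto (fun i => unif {k | (σ i s).symm ((σ i t).symm k) ≠ (σ i (t * s)).symm k})
      atTop (nhds 0) := by
  have h := hσ.1 t s
  have hd : ∀ᶠ i in atTop, d i ≠ 0 := by
    filter_upwards [h.eventually (lt_mem_nhds (zero_lt_one' ℝ))] with i hi hd
    have h0 : ((d i : ℕ) : ℝ) = 0 := by exact_mod_cast hd
    exact lt_irrefl _ (hi.trans_eq (by rw [h0, div_zero]))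
  have h' : Tendsto (fun i => 1 - (({k : Fin (d i) | σ i (t * s) k = σ i t (σ i s k)}.ncard : ℝ))
      / d i) atTop (nhds 0) := by
    simpa using h.const_sub 1
  refine h'.congr' ?_
  filter_upwards [hd] with i hi
  have e : {k | (σ i s).symm ((σ i t).symm k) ≠ (σ i (t * s)).symm k} =
      (σ i (t * s)) '' {k : Fin (d i) | σ i (t * s) k = σ i t (σ i s k)}ᶜ := by
    ext k
    simp only [Set.mem_ofPred_eq, Set.mem_image, Set.mem_compl_iff]
    constructor
    · intro hk
      refine ⟨(σ i (t * s)).symm k, ?_, by simp⟩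
      intro hc
      apply hk
      rw [Equiv.apply_symm_apply] at hc
      rw [Equiv.symm_apply_eq, Equiv.symm_apply_eq, ← hc]
    · rintro ⟨k', hk', rfl⟩ hc
      apply hk'
      rw [Equiv.symm_apply_apply, Equiv.symm_apply_eq, Equiv.symm_apply_eq] at hc
      exact hc
  rw [e, unif, Set.ncard_image_of_injective _ (σ i (t * s)).injective]
  have := Set.ncard_add_ncard_compl {k : Fin (d i) | σ i (t * s) k = σ i t (σ i s k)}
  rw [Nat.card_fin] at this
  have hR : ((({k : Fin (d i) | σ i (t * s) k = σ i t (σ i s k)}.ncard : ℕ) : ℝ)) +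
    (({k : Fin (d i) | σ i (t * s) k = σ i t (σ i s k)}ᶜ).ncard : ℝ) = (d i : ℝ) := by
    exact_mod_cast this
  have hi' : (d i : ℝ) ≠ 0 := by exact_mod_cast hi
  field_simp
  linarith

/-- `D` is determined by the labels of `Q` at the translates in `K`. -/
def Det (G : Type*) [Group G] {X : Type*} [MulAction G X] {ι κ : Type*}
    (Q : X → ι) (K : Finset G) (D : X → κ) : Prop :=
  ∀ x y, (∀ s ∈ K, nmX G Q x s = nmX G Q y s) → D x = D y

/-- Cylinder sets over a sub-σ-algebra. -/
def Cyl (G : Type*) [Group G] {X : Type*} [MulAction G X] (mT : MeasurableSpace X) :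
    Set (Set X) :=
  {D | ∃ (m : ℕ) (Q : X → Fin m) (K : Finset G), Measurable[mT] Q ∧ Det G Q K (fun x => x ∈ D)}

lemma join_cyl {ι : Type*} [Fintype ι] (mT : MeasurableSpace X) (D : ι → Set X)
    (hD : ∀ j, D j ∈ Cyl G mT) :
    ∃ (m : ℕ) (Q : X → Fin m) (K : Finset G), Measurable[mT] Q ∧
      ∀ j, Det G Q K (fun x => x ∈ D j) := by
  classical
  choose m Q K hQ hK using hD
  let e := Fintype.equivFin (∀ j, Fin (m j))
  refine ⟨_, fun x => e (fun j => Q j x), Finset.univ.biUnion K, ?_, ?_⟩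
  · exact (Measurable.of_discrete (f := e)).comp (measurable_pi_lambda _ hQ)
  · intro j x y h
    refine hK j x y fun s hs => ?_
    have := h s (Finset.mem_biUnion.2 ⟨j, Finset.mem_univ _, hs⟩)
    simp only [nmX] at this ⊢
    exact congrFun (e.injective this) j

lemma cyl_algebra (mT : MeasurableSpace X) : IsSetAlgebra (Cyl G mT) where
  empty_mem := ⟨1, fun _ => 0, ∅, measurable_const, fun x y _ => by simp⟩
  compl_mem := by
    rintro D ⟨m, Q, K, hQ, hK⟩
    refine ⟨m, Q, K, hQ, fun x y h => ?_⟩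
    have := hK x y h
    simp only [eq_iff_iff, Set.mem_compl_iff] at this ⊢
    rw [this]
  union_mem := by
    intro D D' h h'
    obtain ⟨m, Q, K, hQ, hK⟩ := join_cyl (G := G) mT (fun b : Bool => if b then D else D')
      (by intro b; cases b <;> simpa)
    refine ⟨m, Q, K, hQ, fun x y hxy => ?_⟩
    have h1 := hK true x y hxy
    have h2 := hK false x y hxy
    simp only [eq_iff_iff, Set.mem_union] at h1 h2 ⊢
    simp only [if_true, Bool.false_eq_true, if_false] at h1 h2
    rw [h1, h2]

lemma cyl_measurable {X : Type*} (mT : MeasurableSpace X) [mX : MeasurableSpace X] [MulAction G X]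
    (hact : ∀ g : G, Measurable (fun x : X => g • x))
    (hT : mT ≤ mX) (D : Set X) (hD : D ∈ Cyl G mT) :
    MeasurableSet[mX] D := by
  obtain ⟨m, Q, K, hQ, hK⟩ := hD
  have hQ' : Measurable Q := hQ.mono hT le_rfl
  let h : X → ({s // s ∈ K} → Fin m) := fun x s => Q ((s : G)⁻¹ • x)
  have hm : Measurable h := measurable_pi_lambda _ fun s => hQ'.comp (hact _)
  have : D = h ⁻¹' (h '' D) := by
    refine Set.Subset.antisymm (Set.subset_preimage_image _ _) ?_
    rintro x ⟨y, hy, hyx⟩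
    have := hK x y fun s hs => (congrFun hyx ⟨s, hs⟩).symm
    simp only [eq_iff_iff] at this
    exact this.2 hy
  rw [this]
  exact hm (Set.toFinite _).measurableSet

lemma approx_set {X : Type*} (mT : MeasurableSpace X) [mX : MeasurableSpace X] [MulAction G X]
    (μ : Measure X) [IsProbabilityMeasure μ]
    (hact : ∀ g : G, Measurable (fun x : X => g • x))
    (hT : IsGenerating G μ mT) (B : Set X) (hB : MeasurableSet B)
    (ε : ℝ) (hε : 0 < ε) : ∃ D ∈ Cyl G mT, μ.real (symmDiff B D) ≤ ε := by
  obtain ⟨hle, hgen⟩ := hT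
  obtain ⟨B', hB', hBB'⟩ := hgen B hB
  have hle' : MeasurableSpace.generateFrom (Cyl G mT) ≤ mX :=
    MeasurableSpace.generateFrom_le (cyl_measurable mT hact hle)
  have hinv : invGen G mT ≤ MeasurableSpace.generateFrom (Cyl G mT) := by
    classical
    refine MeasurableSpace.generateFrom_le ?_
    rintro C ⟨g, A, hA, rfl⟩
    refine MeasurableSpace.measurableSet_generateFrom ?_
    refine ⟨2, fun x => if x ∈ A then 1 else 0, {g}, ?_, ?_⟩
    · exact Measurable.ite hA measurable_const measurable_const
    · intro x y h
      have := h g (by simp)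
      simp only [nmX] at this
      simp only [eq_iff_iff, Set.mem_smul_set_iff_inv_smul_mem]
      by_cases h1 : g⁻¹ • x ∈ A <;> by_cases h2 : g⁻¹ • y ∈ A <;> simp [h1, h2] at this ⊢
  have hfin : IsFiniteMeasure (μ.trim hle') := isFiniteMeasure_trim hle'
  have hdense := @Measure.MeasureDense.of_generateFrom_isSetAlgebra_finite X
    (MeasurableSpace.generateFrom (Cyl G mT)) (μ.trim hle') (Cyl G mT) hfin
    (cyl_algebra mT) rfl
  obtain ⟨D, hD, hDε⟩ := @Measure.MeasureDense.approx X
    (MeasurableSpace.generateFrom (Cyl G mT)) (μ.trim hle') (Cyl G mT) hdense B' (hinv _ hB')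
    (@measure_ne_top X (MeasurableSpace.generateFrom (Cyl G mT)) (μ.trim hle') hfin B') ε hε
  refine ⟨D, hD, ?_⟩
  have hD' : MeasurableSet[MeasurableSpace.generateFrom (Cyl G mT)] (symmDiff B' D) :=
    MeasurableSet.symmDiff (hinv _ hB') (MeasurableSpace.measurableSet_generateFrom hD)
  rw [trim_measurableSet_eq hle' hD'] at hDε
  have h3 : μ (symmDiff B D) ≤ ENNReal.ofReal ε :=
    (measure_symmDiff_le B B' D).trans (by rw [hBB', zero_add]; exact hDε.le)
  exact ENNReal.toReal_le_of_le_ofReal hε.le h3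

lemma approx_label {X : Type*} (mT : MeasurableSpace X) [mX : MeasurableSpace X] [MulAction G X]
    (μ : Measure X) [IsProbabilityMeasure μ]
    (hact : ∀ g : G, Measurable (fun x : X => g • x))
    (hT : IsGenerating G μ mT) {n : ℕ} (P : X → Fin n)
    (hP : Measurable P) (ε : ℝ) (hε : 0 < ε) :
    ∃ (m : ℕ) (Q : X → Fin m) (K : Finset G) (e : (G → Fin m) → Fin n),
      Measurable[mT] Q ∧ (∀ f g, (∀ s ∈ K, f s = g s) → e f = e g) ∧
      μ.real {x | P x ≠ e (nmX G Q x)} ≤ ε := by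
  classical
  obtain ⟨x0⟩ : Nonempty X := nonempty_of_isProbabilityMeasure μ
  have hn : 0 < n := Fin.pos (P x0)
  have hn' : (0 : ℝ) < n := by exact_mod_cast hn
  choose D hD hDε using fun j : Fin n =>
    approx_set mT μ hact hT (P ⁻¹' {j}) (hP (measurableSet_singleton j)) (ε / n) (by positivity)
  obtain ⟨m, Q, K, hQ, hK⟩ := join_cyl mT D hD
  let P' : X → Fin n := fun x => if h : ∃ j, x ∈ D j then h.choose else P x0
  have hP' : Det G Q K P' := by
    intro x y hxy
    have : (fun j => x ∈ D j) = fun j => y ∈ D j := funext fun j => hK j x y hxy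
    simp only [P']
    simp only [this]
  let e : (G → Fin m) → Fin n := fun f =>
    if h : ∃ x, ∀ s ∈ K, nmX G Q x s = f s then P' h.choose else P x0
  have he : ∀ x, e (nmX G Q x) = P' x := by
    intro x
    have h : ∃ y, ∀ s ∈ K, nmX G Q y s = nmX G Q x s := ⟨x, fun _ _ => rfl⟩
    simp only [e]
    rw [dif_pos h]
    exact hP' _ _ h.choose_spec
  refine ⟨m, Q, K, e, hQ, ?_, ?_⟩
  · intro f g hfg
    have : (fun x => ∀ s ∈ K, nmX G Q x s = f s) = fun x => ∀ s ∈ K, nmX G Q x s = g s := by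
      funext x
      refine propext (forall₂_congr fun s hs => ?_)
      rw [hfg s hs]
    simp only [e]
    simp only [this]
  · simp_rw [he]
    calc μ.real {x | P x ≠ P' x} ≤ μ.real (⋃ j, symmDiff (P ⁻¹' {j}) (D j)) := by
          refine measureReal_mono ?_
          intro x hx
          by_contra hc
          apply hx
          have hc' : ∀ j, (P x = j ↔ x ∈ D j) := by
            intro j
            by_contra hj
            apply hc
            refine Set.mem_iUnion.2 ⟨j, ?_⟩
            rw [Set.mem_symmDiff]
            simp only [Set.mem_preimage, Set.mem_singleton_iff]
            tauto
          have h : ∃ j, x ∈ D j := ⟨P x, (hc' _).1 rfl⟩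
          simp only [P']
          rw [dif_pos h]
          exact (hc' _).2 h.choose_spec
      _ ≤ ∑ j, μ.real (symmDiff (P ⁻¹' {j}) (D j)) := measureReal_iUnion_fintype_le _
      _ ≤ ∑ j : Fin n, ε / n := Finset.sum_le_sum fun j _ => hDε j
      _ = ε := by simp; field_simp

lemma count_bound {d n n' : ℕ} (ε κ : ℝ)
    (hball : ∀ v : Fin d → Fin n,
      (((Finset.univ.filter fun w : Fin d → Fin n =>
        ((Finset.univ.filter fun k => w k ≠ v k).card : ℝ) ≤ ε * d).card : ℕ) : ℝ)
        ≤ Real.exp (κ * d))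
    (W : Set (Fin n → Set (Fin d))) (V : Set (Fin n' → Set (Fin d))) (τ : Equiv.Perm (Fin d))
    (c : (Fin d → Fin n') → (Fin d → Fin n))
    (h : ∀ w ∈ W, ∃ (a : Fin d → Fin n) (u : Fin d → Fin n'),
      w = (fun j => {k | a k = j}) ∧ (fun j => {k | u (τ k) = j}) ∈ V ∧
      ((Finset.univ.filter fun k => a k ≠ c u k).card : ℝ) ≤ ε * d) :
    (W.ncard : ℝ) ≤ V.ncard * Real.exp (κ * d) := by
  classical
  rcases W.eq_empty_or_nonempty with rfl | ⟨w1, hw1⟩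
  · simp only [Set.ncard_empty, Nat.cast_zero]; positivity
  obtain ⟨a1, u1, -⟩ := h w1 hw1
  have : Nonempty (Fin d → Fin n) := ⟨a1⟩
  have : Nonempty (Fin d → Fin n') := ⟨u1⟩
  choose! a u ha hu hd using h
  have hW := W.toFinite
  have hV := V.toFinite
  rw [Set.ncard_eq_toFinset_card W hW, Set.ncard_eq_toFinset_card V hV]
  have key : hW.toFinset.card ≤ ⌊Real.exp (κ * d)⌋₊ * hV.toFinset.card := by
    refine Finset.card_le_mul_card_image_of_maps_to
      (f := fun w => (fun j => {k | u w (τ k) = j})) ?_ _ ?_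
    · intro w hw
      rw [Set.Finite.mem_toFinset] at hw ⊢
      exact hu w hw
    · intro v _
      rcases (hW.toFinset.filter fun w => (fun j => {k | u w (τ k) = j}) = v).eq_empty_or_nonempty
        with he | ⟨w0, hw0⟩
      · rw [he]; simp
      · rw [Nat.le_floor_iff (Real.exp_pos _).le]
        refine le_trans ?_ (hball (c (u w0)))
        norm_cast
        refine Finset.card_le_card_of_injOn a ?_ ?_
        · intro w hw
          simp only [Finset.coe_filter, Set.Finite.mem_toFinset, Set.mem_ofPred_eq] at hw
          simp only [Finset.mem_filter, Set.Finite.mem_toFinset] at hw0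
          have huu : u w = u w0 := by
            have e := hw.2.trans hw0.2.symm
            funext k
            have := congrFun e (u w k)
            have hk : τ.symm k ∈ {k' | u w (τ k') = u w k} := by simp
            rw [this] at hk
            simpa using hk.symm
          simp only [Finset.coe_filter, Finset.mem_univ, true_and, Set.mem_ofPred_eq]
          rw [← huu]
          exact hd w hw.1
        · intro w hw w' hw' hww
          simp only [Finset.coe_filter, Set.Finite.mem_toFinset, Set.mem_ofPred_eq] at hw hw'
          rw [ha w hw.1, ha w' hw'.1, hww]
  have key' : (hW.toFinset.card : ℝ) ≤ (⌊Real.exp (κ * d)⌋₊ : ℝ) * hV.toFinset.card := by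
    exact_mod_cast key
  have hf := Nat.floor_le (Real.exp_pos (κ * d)).le
  calc (hW.toFinset.card : ℝ) ≤ (⌊Real.exp (κ * d)⌋₊ : ℝ) * hV.toFinset.card := key'
    _ ≤ Real.exp (κ * d) * hV.toFinset.card := by gcongr
    _ = _ := by ring

lemma micro (μ : Measure X) [IsProbabilityMeasure μ]
    (hact : ∀ g : G, MeasurePreserving (fun x : X => g • x) μ μ)
    {n n' m p d : ℕ} (P : X → Fin n) (Q : X → Fin n') (α : X → Fin m) (β : X → Fin p)
    (r : Fin m → Fin n) (q : Fin p → Fin n')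
    (hα : Measurable α) (hr : ∀ x, r (α x) = P x) (hq : ∀ x, q (β x) = Q x)
    (K L M F : Finset G) (h1L : (1 : G) ∈ L)
    (e : (G → Fin n') → Fin n) (he : ∀ f g, (∀ s ∈ K, f s = g s) → e f = e g)
    (c : (G → Fin m) → Fin p) (hc : ∀ f g, (∀ s ∈ M, f s = g s) → c f = c g)
    (h1F : (1 : G) ∈ F) (hF : ∀ t ∈ L ∪ K, ∀ s ∈ M, t * s ∈ F)
    (σ : G → Equiv.Perm (Fin d)) (δ δ' ε ε0 ρ : ℝ)
    (hPe : μ.real {x | P x ≠ e (nmX G Q x)} ≤ ε0 / 4)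
    (hβc : μ.real {x | β x ≠ c (nmX G α x)} ≤ ε)
    (hε : (L ∪ K).card * ε ≤ ρ)
    (hbad : unif (⋃ t ∈ L ∪ K, ⋃ s ∈ M,
      {k | (σ s).symm ((σ t).symm k) ≠ (σ (t * s)).symm k}) ≤ ρ)
    (hδ' : (1 + F.card) * δ' ≤ ρ) (hρ : ρ ≤ ε0 / 8)
    (hρδ : Fintype.card ({s // s ∈ L} → Fin p) * (3 * ρ) < δ)
    (hσ2 : unif {k | (σ 1).symm k ≠ k} ≤ ρ)
    (hσ1 : p * unif {k | (σ 1).symm k ≠ k} < δ)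
    (φ : (G → Fin m) → Set (Fin d)) (hφ : IsHom μ (fun j => α ⁻¹' {j}) F δ' σ φ) :
    ∃ (a : Fin d → Fin n) (u : Fin d → Fin n'),
      restrictHom r φ = (fun j => {k | a k = j}) ∧
      (fun j => {k | u ((σ 1).symm k) = j}) ∈
        restrictHom q '' {ψ | IsHom μ (fun j => β ⁻¹' {j}) L δ σ ψ} ∧
      ((Finset.univ.filter fun k => a k ≠ e (nmD σ u k)).card : ℝ) ≤ ε0 * d := by
  classical
  have : MeasurableConstSMul G X := ⟨fun g => (hact g).measurable⟩
  have : SMulInvariantMeasure G X μ :=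
    ⟨fun g s hs => (hact g).measure_preimage hs.nullMeasurableSet⟩
  obtain ⟨a, ha, haE⟩ := hom_to_label μ (fun g => (hact g).measurable)
    (A := fun j => α ⁻¹' {j}) (l := α) (by intro i x; simp) hα h1F hφ
  replace haE := fun E hE => (haE E hE).trans hδ'
  set Bad := ⋃ t ∈ L ∪ K, ⋃ s ∈ M,
      {k | (σ s).symm ((σ t).symm k) ≠ (σ (t * s)).symm k} with hBad
  let b : Fin d → Fin p := fun k => c (nmD σ a k)
  let sh : (G → Fin m) → G → (G → Fin m) := fun g t s => g (t * s)
  have hb : ∀ k, k ∉ Bad → ∀ t ∈ L ∪ K, b ((σ t).symm k) = c (sh (nmD σ a k) t) := by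
    intro k hk t ht
    refine hc _ _ fun s hs => ?_
    have : (σ s).symm ((σ t).symm k) = (σ (t * s)).symm k := by
      by_contra hne
      exact hk (Set.mem_biUnion ht (Set.mem_biUnion hs hne))
    simp only [nmD, sh, this]
  have hshX : ∀ x t, nmX G α (t⁻¹ • x) = sh (nmX G α x) t := by
    intro x t
    funext s
    simp [nmX, sh, mul_smul]
  let DX : Set X := ⋃ t ∈ L ∪ K, (fun x => t⁻¹ • x) ⁻¹' {x | β x ≠ c (nmX G α x)}
  have hDX : μ.real DX ≤ ρ := by
    refine (measureReal_biUnion_finset_le _ _).trans (le_trans ?_ hε)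
    calc _ ≤ ∑ t ∈ L ∪ K, ε := by
          refine Finset.sum_le_sum fun t _ => ?_
          rw [measureReal_def, measure_preimage_smul]
          exact hβc
      _ = _ := by simp
  have hXc : ∀ x, x ∉ DX → ∀ t ∈ L ∪ K, β (t⁻¹ • x) = c (sh (nmX G α x) t) := by
    intro x hx t ht
    by_contra hne
    refine hx (Set.mem_biUnion ht ?_)
    simp only [Set.mem_preimage, Set.mem_ofPred_eq, hshX]
    exact hne
  have hcsh : ∀ g g' : G → Fin m, (∀ s ∈ F, g s = g' s) → ∀ t ∈ L ∪ K,
      c (sh g t) = c (sh g' t) := by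
    intro g g' h t ht
    exact hc _ _ fun s hs => h _ (hF t ht s hs)
  -- the approximate measure preservation of `b`
  have hcell : ∀ f : {s // s ∈ L} → Fin p,
      |unif {k | ∀ s : {s // s ∈ L}, nmD σ b k s = f s} -
        μ.real {x | ∀ s : {s // s ∈ L}, nmX G β x s = f s}| ≤ 3 * ρ := by
    intro f
    let E : Set (G → Fin m) := {g | ∀ t : {s // s ∈ L}, c (sh g t) = f t}
    have hE : DepSet F E := by
      intro g g' h
      simp only [E, Set.mem_ofPred_eq]
      refine forall_congr' fun t => ?_
      rw [hcsh g g' h t (Finset.mem_union_left _ t.2)]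
    have h1 : |unif {k | ∀ s : {s // s ∈ L}, nmD σ b k s = f s} - unif {k | nmD σ a k ∈ E}|
        ≤ ρ := by
      rw [unif_eq, unif_eq]
      refine (abs_real_sub_le _ (D := Bad) ?_).trans (by rw [← unif_eq]; exact hbad)
      intro k hk
      simp only [E, Set.mem_ofPred_eq]
      refine forall_congr' fun t => ?_
      rw [← hb k hk t (Finset.mem_union_left _ t.2)]
      rfl
    have h2 := haE E hE
    have h3 : |μ.real {x | nmX G α x ∈ E} -
        μ.real {x | ∀ s : {s // s ∈ L}, nmX G β x s = f s}| ≤ ρ := by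
      refine (abs_real_sub_le _ (D := DX) ?_).trans hDX
      intro x hx
      simp only [E, Set.mem_ofPred_eq]
      refine forall_congr' fun t => ?_
      rw [← hXc x hx t (Finset.mem_union_left _ t.2)]
      rfl
    rw [abs_le] at h1 h2 h3 ⊢
    constructor <;> linarith [h1.1, h1.2, h2.1, h2.2, h3.1, h3.2]
  obtain ⟨ψ, hψ, hψr⟩ := label_to_hom μ (A := fun j => β ⁻¹' {j}) (l := β)
    (by intro i x; simp) h1L (δ := δ) b hσ1 (by
      refine lt_of_le_of_lt (Finset.sum_le_sum fun f _ => hcell f) ?_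
      simpa using hρδ)
  refine ⟨fun k => r (a k), fun k => q (b k), ha n r, ⟨ψ, hψ, hψr n' q⟩, ?_⟩
  -- the Hamming distance estimate
  let E : Set (G → Fin m) := {g | r (g 1) ≠ e (fun t => q (c (sh g t)))}
  have hE : DepSet F E := by
    intro g g' h
    simp only [E, Set.mem_ofPred_eq]
    rw [h 1 h1F, he (fun t => q (c (sh g t))) (fun t => q (c (sh g' t))) ?_]
    intro t ht
    rw [hcsh g g' h t (Finset.mem_union_right _ ht)]
  have hEX : μ.real {x | nmX G α x ∈ E} ≤ ε0 / 4 + ρ := by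
    refine (measureReal_mono (s₂ := {x | P x ≠ e (nmX G Q x)} ∪ DX) ?_).trans
      ((measureReal_union_le _ _).trans (add_le_add hPe hDX))
    intro x hx
    by_cases hxD : x ∈ DX
    · exact Or.inr hxD
    · left
      simp only [E, Set.mem_ofPred_eq] at hx ⊢
      have e1 : r (nmX G α x 1) = P x := by simp [nmX, hr]
      rw [e1, he (fun t => q (c (sh (nmX G α x) t))) (nmX G Q x) ?_] at hx
      · exact hx
      · intro t ht
        rw [← hXc x hxD t (Finset.mem_union_right _ ht), hq]
        rfl
  have hED : unif {k | nmD σ a k ∈ E} ≤ ε0 / 4 + 2 * ρ := by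
    have := (abs_le.1 (haE E hE)).2
    linarith
  have hfin : unif {k | r (a k) ≠ e (nmD σ (fun k => q (b k)) k)} ≤ ε0 := by
    rw [unif_eq] at hED hbad hσ2 ⊢
    have hsub : {k | r (a k) ≠ e (nmD σ (fun k => q (b k)) k)} ⊆
        ({k | nmD σ a k ∈ E} ∪ Bad) ∪ {k | (σ 1).symm k ≠ k} := by
      intro k hk
      by_cases h1 : (σ 1).symm k = k
      · left
        by_cases h2 : k ∈ Bad
        · exact Or.inr h2
        · left
          simp only [E, Set.mem_ofPred_eq] at hk ⊢
          have e1 : nmD σ a k 1 = a k := by simp only [nmD, h1]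
          rw [e1, he (fun t => q (c (sh (nmD σ a k) t))) (nmD σ (fun k => q (b k)) k) ?_]
          · exact hk
          · intro t ht
            rw [← hb k h2 t (Finset.mem_union_right _ ht)]
            rfl
      · exact Or.inr h1
    have h3 := measureReal_mono (μ := unifM d) hsub
    have h4 := measureReal_union_le (μ := unifM d) ({k | nmD σ a k ∈ E} ∪ Bad)
      {k | (σ 1).symm k ≠ k}
    have h5 := measureReal_union_le (μ := unifM d) {k | nmD σ a k ∈ E} Bad
    have hμ0 : 0 ≤ μ.real {x | P x ≠ e (nmX G Q x)} := measureReal_nonneg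
    linarith
  have hcard : (Finset.univ.filter fun k => r (a k) ≠ e (nmD σ (fun k => q (b k)) k)).card =
      {k | r (a k) ≠ e (nmD σ (fun k => q (b k)) k)}.ncard := by
    rw [← Set.ncard_coe_finset]
    congr 1
    ext k; simp
  rw [hcard]
  rcases Nat.eq_zero_or_pos d with hd | hd
  · subst hd
    simp [Set.eq_empty_of_isEmpty]
  · have hd' : (0 : ℝ) < d := by exact_mod_cast hd
    unfold unif at hfin
    rwa [div_le_iff₀ hd'] at hfin

lemma core {X : Type*} (mS mT : MeasurableSpace X) [mX : MeasurableSpace X] [MulAction G X]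
    (μ : Measure X) [IsProbabilityMeasure μ]
    (hact : ∀ g : G, MeasurePreserving (fun x : X => g • x) μ μ)
    (d : ℕ → ℕ) (σ : ∀ i, G → Equiv.Perm (Fin (d i))) (hσ : IsSoficApprox d σ)
    (hS : IsGenerating G μ mS) (hT : IsGenerating G μ mT) {n : ℕ} (P : X → Fin n)
    (hP : Measurable[mS] P) (κ : ℝ) (hκ : 0 < κ) :
    ∃ (n' : ℕ) (Q : X → Fin n'), Measurable[mT] Q ∧
      ∀ (p : ℕ) (β : X → Fin p) (q : Fin p → Fin n'), Measurable[mT] β → (∀ x, q (β x) = Q x) →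
      ∀ (L : Finset G) (δ : ℝ), 1 ∈ L → 0 < δ →
      ∃ (m : ℕ) (α : X → Fin m) (r : Fin m → Fin n), Measurable[mS] α ∧ (∀ x, r (α x) = P x) ∧
      ∃ (F : Finset G) (δ' : ℝ), 1 ∈ F ∧ 0 < δ' ∧ ∀ᶠ i in atTop,
        (homCount μ (fun j => α ⁻¹' {j}) r F δ' (σ i) : ℝ) ≤
          homCount μ (fun j => β ⁻¹' {j}) q L δ (σ i) * Real.exp (κ * d i) := by
  classical
  have hact' : ∀ g : G, Measurable (fun x : X => g • x) := fun g => (hact g).measurable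
  obtain ⟨ε0, hε0, hball⟩ := ball_bound n κ hκ
  obtain ⟨n', Q, K, e, hQ, he, hPe⟩ := approx_label mT μ hact' hT P (hP.mono hS.1 le_rfl)
    (ε0 / 4) (by positivity)
  refine ⟨n', Q, hQ, fun p β q hβ hq L δ h1L hδ => ?_⟩
  set Nf : ℝ := ((Fintype.card ({s // s ∈ L} → Fin p) : ℕ) : ℝ) with hNf
  have hNf0 : 0 ≤ Nf := Nat.cast_nonneg _
  set ρ : ℝ := min (ε0 / 8) (δ / (4 * (Nf + 1))) with hρdef
  have hρ0 : 0 < ρ := lt_min (by positivity) (by positivity)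
  have hρδ : Nf * (3 * ρ) < δ := by
    have h : ρ ≤ δ / (4 * (Nf + 1)) := min_le_right _ _
    rw [le_div_iff₀ (by positivity)] at h
    nlinarith
  obtain ⟨m', γ, M, c, hγ, hc, hβc⟩ := approx_label mS μ hact' hS β (hβ.mono hT.1 le_rfl)
    (ρ / ((L ∪ K).card + 1)) (by positivity)
  let eqv := Fintype.equivFin (Fin n × Fin m')
  let α : X → Fin (Fintype.card (Fin n × Fin m')) := fun x => eqv (P x, γ x)
  have hαm : Measurable[mS] α :=
    (Measurable.of_discrete (f := eqv)).comp (Measurable.prodMk hP hγ)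
  let r : Fin (Fintype.card (Fin n × Fin m')) → Fin n := fun j => (eqv.symm j).1
  let c' : (G → Fin (Fintype.card (Fin n × Fin m'))) → Fin p :=
    fun f => c (fun s => (eqv.symm (f s)).2)
  let F : Finset G := insert 1 (Finset.image₂ (· * ·) (L ∪ K) M)
  have hr : ∀ x, r (α x) = P x := by intro x; simp [r, α]
  refine ⟨_, α, r, hαm, hr, F, ρ / (1 + F.card), Finset.mem_insert_self _ _, by positivity, ?_⟩
  have hbad : Tendsto (fun i => unif (⋃ t ∈ L ∪ K, ⋃ s ∈ M,
      {k | (σ i s).symm ((σ i t).symm k) ≠ (σ i (t * s)).symm k})) atTop (nhds 0) := by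
    have hsum : Tendsto (fun i => ∑ t ∈ L ∪ K, ∑ s ∈ M,
        unif {k | (σ i s).symm ((σ i t).symm k) ≠ (σ i (t * s)).symm k}) atTop (nhds 0) := by
      have := tendsto_finsetSum (L ∪ K) fun t _ => tendsto_finsetSum M fun s _ =>
        sofic_bad d σ hσ s t
      simpa using this
    refine squeeze_zero (fun i => by unfold unif; positivity) (fun i => ?_) hsum
    simp_rw [unif_eq]
    refine (measureReal_biUnion_finset_le _ _).trans (Finset.sum_le_sum fun t _ => ?_)
    exact measureReal_biUnion_finset_le _ _
  have hone : Tendsto (fun i => unif {k | (σ i 1).symm k ≠ k}) atTop (nhds 0) := by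
    refine (sofic_bad d σ hσ 1 1).congr fun i => ?_
    congr 1
    ext k
    simp only [Set.mem_ofPred_eq, mul_one]
    rw [not_iff_not, (σ i 1).symm.injective.eq_iff]
  have hone' : Tendsto (fun i => p * unif {k | (σ i 1).symm k ≠ k}) atTop (nhds 0) := by
    simpa using hone.const_mul (p : ℝ)
  filter_upwards [hbad.eventually (ge_mem_nhds hρ0), hone.eventually (ge_mem_nhds hρ0),
    hone'.eventually (gt_mem_nhds hδ)] with i hi1 hi2 hi3
  refine count_bound ε0 κ (hball (d i)) _ _ (σ i 1).symm (fun u k => e (nmD (σ i) u k)) ?_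
  rintro w ⟨φ, hφ, rfl⟩
  refine micro μ hact P Q α β r q (hαm.mono hS.1 le_rfl) hr hq K L M F h1L e he c' ?_
    (Finset.mem_insert_self _ _) ?_ (σ i) δ _ (ρ / ((L ∪ K).card + 1)) ε0 ρ hPe ?_ ?_ hi1 ?_
    (min_le_left _ _) hρδ hi2 hi3 φ hφ
  · intro f g h
    refine hc _ _ fun s hs => ?_
    rw [h s hs]
  · intro t ht s hs
    exact Finset.mem_insert_of_mem (Finset.mem_image₂_of_mem ht hs)
  · convert hβc using 5 with x
    simp [c', nmX, α]
    rfl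
  · rw [mul_div_assoc', div_le_iff₀ (by positivity)]
    nlinarith
  · rw [mul_div_cancel₀]
    positivity

lemma homCount_le (μ : Measure X) [IsFiniteMeasure μ]
    (hact : ∀ g : G, Measurable (fun x : X => g • x)) {m n : ℕ} {A : Fin m → Set X}
    (hA : IsFinPartition A) (r : Fin m → Fin n) {F : Finset G} (h1 : (1 : G) ∈ F) (δ : ℝ) {d : ℕ}
    (σ : G → Equiv.Perm (Fin d)) : homCount μ A r F δ σ ≤ n ^ d := by
  classical
  obtain ⟨l, hl⟩ := exists_label hA
  have hlm : Measurable l := by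
    refine measurable_to_countable' fun i => ?_
    have : l ⁻¹' {i} = A i := by ext x; simp [hl]
    rw [this]; exact hA.1 i
  have hsub : restrictHom r '' {φ | IsHom μ A F δ σ φ} ⊆
      (fun w : Fin d → Fin n => fun j => {k | w k = j}) '' Set.univ := by
    rintro _ ⟨φ, hφ, rfl⟩
    obtain ⟨a, ha, -⟩ := hom_to_label μ hact hl hlm h1 hφ
    exact ⟨fun k => r (a k), trivial, (ha n r).symm⟩
  unfold homCount
  refine (Set.ncard_le_ncard hsub (Set.toFinite _)).trans ((Set.ncard_image_le (Set.toFinite _)).trans ?_)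
  rw [Set.ncard_univ]
  simp

lemma log_nonneg_le (μ : Measure X) [IsFiniteMeasure μ]
    (hact : ∀ g : G, Measurable (fun x : X => g • x)) {m n : ℕ} {A : Fin m → Set X}
    (hA : IsFinPartition A) (r : Fin m → Fin n) {F : Finset G} (h1 : (1 : G) ∈ F) (δ : ℝ) {d : ℕ}
    (σ : G → Equiv.Perm (Fin d)) :
    0 ≤ Real.log (homCount μ A r F δ σ) / d ∧ Real.log (homCount μ A r F δ σ) / d ≤ Real.log n := by
  have h0 : 0 ≤ Real.log (homCount μ A r F δ σ) := Real.log_natCast_nonneg _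
  refine ⟨div_nonneg h0 (Nat.cast_nonneg _), ?_⟩
  refine div_le_of_le_mul₀ (Nat.cast_nonneg _) (Real.log_natCast_nonneg _) ?_
  rcases Nat.eq_zero_or_pos (homCount μ A r F δ σ) with h | h
  · rw [h]; simp only [Nat.cast_zero, Real.log_zero]
    exact mul_nonneg (Real.log_natCast_nonneg _) (Nat.cast_nonneg _)
  · have := homCount_le μ hact hA r h1 δ σ
    have h' : (0 : ℝ) < homCount μ A r F δ σ := by exact_mod_cast h
    calc Real.log (homCount μ A r F δ σ) ≤ Real.log ((n : ℝ) ^ d) :=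
          Real.log_le_log h' (by exact_mod_cast this)
      _ = _ := by rw [Real.log_pow]; ring

section Bounds

variable (μ : Measure X) [IsFiniteMeasure μ]
    (hact : ∀ g : G, Measurable (fun x : X => g • x))
    (d : ℕ → ℕ) (σ : ∀ i, G → Equiv.Perm (Fin (d i)))

lemma bdd_hFδ (hact : ∀ g : G, Measurable (fun x : X => g • x)) {m n : ℕ} {A : Fin m → Set X}
    (hA : IsFinPartition A) (r : Fin m → Fin n) {F : Finset G} (h1 : (1 : G) ∈ F) (δ : ℝ) :
    IsBoundedUnder (· ≤ ·) atTop (fun i => Real.log (homCount μ A r F δ (σ i)) / d i) ∧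
    IsBoundedUnder (· ≥ ·) atTop (fun i => Real.log (homCount μ A r F δ (σ i)) / d i) :=
  ⟨isBoundedUnder_of ⟨_, fun i => (log_nonneg_le μ hact hA r h1 δ (σ i)).2⟩,
    isBoundedUnder_of ⟨0, fun i => (log_nonneg_le μ hact hA r h1 δ (σ i)).1⟩⟩

lemma hFδ_nonneg (hact : ∀ g : G, Measurable (fun x : X => g • x)) {m n : ℕ} {A : Fin m → Set X}
    (hA : IsFinPartition A) (r : Fin m → Fin n) {F : Finset G} (h1 : (1 : G) ∈ F) (δ : ℝ) :
    0 ≤ hFδ μ A r F δ d σ := by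
  unfold hFδ
  exact le_limsup_of_frequently_le
    (Eventually.frequently (Eventually.of_forall
      fun i => (log_nonneg_le μ hact hA r h1 δ (σ i)).1))
    (bdd_hFδ μ d σ hact hA r h1 δ).1

lemma hPartLoc_nonneg (hact : ∀ g : G, Measurable (fun x : X => g • x)) {m n : ℕ}
    {A : Fin m → Set X} (hA : IsFinPartition A) (r : Fin m → Fin n) :
    0 ≤ hPartLoc μ A r d σ := by
  refine Real.sInf_nonneg ?_
  rintro x ⟨F, δ, h1, -, rfl⟩
  exact hFδ_nonneg μ d σ hact hA r h1 δ

lemma hXi_nonneg (hact : ∀ g : G, Measurable (fun x : X => g • x)) (S : Set (Set X)) {n : ℕ}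
    (P : Fin n → Set X) : 0 ≤ hXi μ S P d σ := by
  refine Real.sInf_nonneg ?_
  rintro x ⟨m, A, r, hA, -, -, rfl⟩
  exact hPartLoc_nonneg μ d σ hact hA r

lemma hXi_le (hact : ∀ g : G, Measurable (fun x : X => g • x)) (S : Set (Set X)) {n m : ℕ}
    {P : Fin n → Set X} {A : Fin m → Set X} {r : Fin m → Fin n} (hA : IsFinPartition A)
    (hAS : ∀ i, A i ∈ S) (hr : PartRefines A P r) {F : Finset G} (h1 : (1 : G) ∈ F) {δ : ℝ}
    (hδ : 0 < δ) : hXi μ S P d σ ≤ hFδ μ A r F δ d σ := by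
  have hstep : hPartLoc μ A r d σ ≤ hFδ μ A r F δ d σ := by
    refine csInf_le ⟨0, ?_⟩ ⟨F, δ, h1, hδ, rfl⟩
    rintro x ⟨F, δ, h1, -, rfl⟩
    exact hFδ_nonneg μ d σ hact hA r h1 δ
  refine le_trans ?_ hstep
  refine csInf_le ⟨0, ?_⟩ ⟨m, A, r, hA, hAS, hr, rfl⟩
  rintro x ⟨m, A, r, hA, -, -, rfl⟩
  exact hPartLoc_nonneg μ d σ hact hA r

lemma le_hXi (S : Set (Set X)) {n : ℕ} {P : Fin n → Set X} (hP : IsFinPartition P)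
    (hPS : ∀ i, P i ∈ S) (x : ℝ)
    (h : ∀ (m : ℕ) (A : Fin m → Set X) (r : Fin m → Fin n), IsFinPartition A → (∀ i, A i ∈ S) →
      PartRefines A P r → ∀ (F : Finset G) (δ : ℝ), (1 : G) ∈ F → 0 < δ →
        x ≤ hFδ μ A r F δ d σ) : x ≤ hXi μ S P d σ := by
  refine le_csInf ⟨_, n, P, id, hP, hPS, fun i => subset_rfl, rfl⟩ ?_
  rintro y ⟨m, A, r, hA, hAS, hr, rfl⟩
  refine le_csInf ⟨_, {1}, 1, by simp, one_pos, rfl⟩ ?_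
  rintro y ⟨F, δ, h1, hδ, rfl⟩
  exact h m A r hA hAS hr F δ h1 hδ

end Bounds

lemma part_of_label {ι : Type*} {m : ℕ} {l : X → Fin m} (hl : Measurable l) :
    IsFinPartition (fun j => l ⁻¹' {j}) := by
  refine ⟨fun i => hl (measurableSet_singleton i), ?_, ?_⟩
  · intro i j hij
    rw [Function.onFun, Set.disjoint_left]
    intro x hx hx'
    exact hij (hx.symm.trans hx')
  · ext x; simp

lemma hFδ_le (μ : Measure X) [IsFiniteMeasure μ]
    (hact : ∀ g : G, Measurable (fun x : X => g • x))
    (d : ℕ → ℕ) (σ : ∀ i, G → Equiv.Perm (Fin (d i))) {m n p n' : ℕ} {A : Fin m → Set X}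
    (hA : IsFinPartition A) {B : Fin p → Set X} (hB : IsFinPartition B) (r : Fin m → Fin n)
    (q : Fin p → Fin n') {F L : Finset G} (h1F : (1 : G) ∈ F) (h1L : (1 : G) ∈ L) {δ δ' κ : ℝ}
    (hκ : 0 < κ)
    (h : ∀ᶠ i in atTop, (homCount μ A r F δ' (σ i) : ℝ) ≤
      homCount μ B q L δ (σ i) * Real.exp (κ * d i)) :
    hFδ μ A r F δ' d σ ≤ hFδ μ B q L δ d σ + κ := by
  obtain ⟨b1, b2⟩ := bdd_hFδ μ d σ hact hB q h1L δ
  obtain ⟨b3, b4⟩ := bdd_hFδ μ d σ hact hA r h1F δ'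
  unfold hFδ
  rw [← limsup_add_const atTop _ κ b1 b2.isCoboundedUnder_le]
  refine limsup_le_limsup ?_ b4.isCoboundedUnder_le ?_
  · filter_upwards [h] with i hi
    have h0 : 0 ≤ Real.log (homCount μ B q L δ (σ i)) / d i :=
      (log_nonneg_le μ hact hB q h1L δ (σ i)).1
    rcases Nat.eq_zero_or_pos (homCount μ A r F δ' (σ i)) with hz | hz
    · rw [hz]; simp only [Nat.cast_zero, Real.log_zero, zero_div]; linarith
    rcases Nat.eq_zero_or_pos (d i) with hd | hd
    · have : ((d i : ℕ) : ℝ) = 0 := by exact_mod_cast hd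
      rw [this, div_zero, div_zero]; linarith
    have hz' : (0 : ℝ) < homCount μ A r F δ' (σ i) := by exact_mod_cast hz
    have hd' : (0 : ℝ) < d i := by exact_mod_cast hd
    have hB0 : (homCount μ B q L δ (σ i) : ℝ) ≠ 0 := by
      intro hc
      rw [hc, zero_mul] at hi
      linarith
    have := Real.log_le_log hz' hi
    rw [Real.log_mul hB0 (Real.exp_pos _).ne', Real.log_exp] at this
    rw [div_le_iff₀ hd', add_mul, div_mul_cancel₀ _ hd'.ne']
    exact this
  · obtain ⟨M, hM⟩ := b1
    refine ⟨M + κ, ?_⟩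
    rw [eventually_map] at hM ⊢
    filter_upwards [hM] with i hi
    linarith

lemma half {X : Type*} (mS mT : MeasurableSpace X) [mX : MeasurableSpace X] [MulAction G X]
    (μ : Measure X) [IsProbabilityMeasure μ]
    (hact : ∀ g : G, MeasurePreserving (fun x : X => g • x) μ μ)
    (d : ℕ → ℕ) (σ : ∀ i, G → Equiv.Perm (Fin (d i))) (hσ : IsSoficApprox d σ)
    (hS : IsGenerating G μ mS) (hT : IsGenerating G μ mT) {n : ℕ} (P : Fin n → Set X)
    (hP : IsFinPartition P) (hPS : ∀ i, MeasurableSet[mS] (P i)) (κ : ℝ) (hκ : 0 < κ) :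
    ∃ (n' : ℕ) (Q : Fin n' → Set X), IsFinPartition Q ∧ (∀ j, MeasurableSet[mT] (Q j)) ∧
      hXi μ {B | MeasurableSet[mS] B} P d σ ≤ hXi μ {B | MeasurableSet[mT] B} Q d σ + κ := by
  have hact' : ∀ g : G, Measurable (fun x : X => g • x) := fun g => (hact g).measurable
  have hlab : ∀ (m0 : MeasurableSpace X) {m : ℕ} (A : Fin m → Set X) (l : X → Fin m),
      (∀ i, MeasurableSet[m0] (A i)) → (∀ i x, x ∈ A i ↔ l x = i) → Measurable[m0] l := by
    intro m0 m A l hA hl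
    refine @measurable_to_countable' _ _ _ _ m0 _ fun i => ?_
    have : l ⁻¹' {i} = A i := by ext x; simp [hl]
    rw [this]; exact hA i
  obtain ⟨P', hP'⟩ := exists_label hP
  obtain ⟨n', Q, hQ, hcore⟩ := core mS mT μ hact d σ hσ hS hT P' (hlab mS P P' hPS hP') κ hκ
  have hQp : IsFinPartition (fun j => Q ⁻¹' {j}) := part_of_label (ι := Unit) (hQ.mono hT.1 le_rfl)
  refine ⟨n', fun j => Q ⁻¹' {j}, hQp, fun j => hQ (measurableSet_singleton j), ?_⟩
  rw [← sub_le_iff_le_add]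
  refine le_hXi μ d σ _ hQp (fun j => hQ (measurableSet_singleton j)) _ ?_
  intro p B q hB hBT hq L δ h1L hδ
  obtain ⟨β, hβ⟩ := exists_label hB
  have hβm : Measurable[mT] β := hlab mT B β hBT hβ
  have hBβ : B = fun j => β ⁻¹' {j} := by
    funext j; ext x; simp [hβ]
  have hqβ : ∀ x, q (β x) = Q x := by
    intro x
    have := hq (β x) ((hβ _ _).2 rfl)
    simpa using this.symm
  obtain ⟨m, α, r, hα, hr, F, δ', h1F, hδ', hcount⟩ := hcore p β q hβm hqβ L δ h1L hδ
  rw [← hBβ] at hcount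
  have hA : IsFinPartition (fun j => α ⁻¹' {j}) := part_of_label (ι := Unit) (hα.mono hS.1 le_rfl)
  rw [sub_le_iff_le_add]
  refine (hXi_le μ d σ hact' _ hA (fun j => hα (measurableSet_singleton j)) (r := r) ?_ h1F
    hδ').trans (hFδ_le μ hact' d σ hA hB r q h1F h1L hκ hcount)
  intro i x hx
  rw [hP', ← hr x]
  exact congrArg r hx

lemma sSup_eq_of_approx {U V : Set ℝ} (hU : U.Nonempty) (hV : V.Nonempty)
    (hUV : ∀ κ : ℝ, 0 < κ → ∀ x ∈ U, ∃ y ∈ V, x ≤ y + κ)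
    (hVU : ∀ κ : ℝ, 0 < κ → ∀ x ∈ V, ∃ y ∈ U, x ≤ y + κ) : sSup U = sSup V := by
  have bdd : ∀ U V : Set ℝ, (∀ κ : ℝ, 0 < κ → ∀ x ∈ U, ∃ y ∈ V, x ≤ y + κ) →
      BddAbove V → BddAbove U := by
    rintro U V h ⟨C, hC⟩
    refine ⟨C + 1, fun x hx => ?_⟩
    obtain ⟨y, hy, hxy⟩ := h 1 one_pos x hx
    linarith [hC hy]
  have le : ∀ U V : Set ℝ, U.Nonempty → (∀ κ : ℝ, 0 < κ → ∀ x ∈ U, ∃ y ∈ V, x ≤ y + κ) →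
      BddAbove V → sSup U ≤ sSup V := by
    intro U V hU h hV
    refine csSup_le hU fun x hx => le_of_forall_pos_le_add fun κ hκ => ?_
    obtain ⟨y, hy, hxy⟩ := h κ hκ x hx
    linarith [le_csSup hV hy]
  by_cases hb : BddAbove V
  · exact le_antisymm (le U V hU hUV hb) (le V U hV hVU (bdd U V hUV hb))
  · rw [Real.sSup_of_not_bddAbove hb, Real.sSup_of_not_bddAbove fun h => hb (bdd V U hVU h)]

lemma hAlg_eq {X : Type*} (mS mT : MeasurableSpace X) [mX : MeasurableSpace X] [MulAction G X]
    (μ : Measure X) [IsProbabilityMeasure μ]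
    (hact : ∀ g : G, MeasurePreserving (fun x : X => g • x) μ μ)
    (d : ℕ → ℕ) (σ : ∀ i, G → Equiv.Perm (Fin (d i))) (hσ : IsSoficApprox d σ)
    (hS : IsGenerating G μ mS) (hT : IsGenerating G μ mT) :
    hAlg μ {B | MeasurableSet[mS] B} d σ = hAlg μ {B | MeasurableSet[mT] B} d σ := by
  have htriv : IsFinPartition (fun _ : Fin 1 => (Set.univ : Set X)) :=
    ⟨fun _ => MeasurableSet.univ, fun i j hij => absurd (Subsingleton.elim i j) hij, Set.iUnion_const _⟩
  refine sSup_eq_of_approx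
    ⟨_, 1, fun _ => Set.univ, htriv, fun _ => @MeasurableSet.univ X mS, rfl⟩
    ⟨_, 1, fun _ => Set.univ, htriv, fun _ => @MeasurableSet.univ X mT, rfl⟩ ?_ ?_
  · rintro κ hκ x ⟨n, P, hP, hPS, rfl⟩
    obtain ⟨n', Q, hQ, hQT, hle⟩ := half mS mT μ hact d σ hσ hS hT P hP hPS κ hκ
    exact ⟨_, ⟨n', Q, hQ, hQT, rfl⟩, hle⟩
  · rintro κ hκ x ⟨n, P, hP, hPS, rfl⟩
    obtain ⟨n', Q, hQ, hQT, hle⟩ := half mT mS μ hact d σ hσ hT hS P hP hPS κ hκ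
    exact ⟨_, ⟨n', Q, hQ, hQT, rfl⟩, hle⟩

lemma generating_self (G : Type*) [Group G] {X : Type*} [mX : MeasurableSpace X] [MulAction G X]
    (μ : Measure X) : IsGenerating G μ mX := by
  refine ⟨le_rfl, fun B hB => ⟨B, ?_, by simp⟩⟩
  exact MeasurableSpace.measurableSet_generateFrom ⟨1, B, hB, by simp⟩

end Helpers

/-- Kolmogorov–Sinai theorem, Theorem 2.6.  Let `(X,B,μ)` be a
probability space with a measure-preserving action of a countable sofic group `G` and `Σ`
a sofic approximation sequence.  If `S` and `T` are two generating σ-subalgebras of `B`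
then `h_{Σ,μ}(S) = h_{Σ,μ}(T)`; in particular, for any generating σ-subalgebra `S`, the
sofic measure entropy `h_{Σ,μ}(X,G) = h_{Σ,μ}(B)` equals `h_{Σ,μ}(S)`. -/
theorem stmt15 {G : Type*} [Group G] [Countable G] [DecidableEq G]
    {X : Type*} [mX : MeasurableSpace X] [MulAction G X]
    (μ : Measure X) [IsProbabilityMeasure μ]
    (hact : ∀ g : G, MeasurePreserving (fun x : X => g • x) μ μ)
    (dseq : ℕ → ℕ) (σ : ∀ i, G → Equiv.Perm (Fin (dseq i)))
    (hσ : IsSoficApprox dseq σ)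
    (S T : Set (Set X))
    (hS : ∃ mS : MeasurableSpace X, IsGenerating (mX := mX) G μ mS ∧ S = {B | MeasurableSet[mS] B})
    (hT : ∃ mT : MeasurableSpace X, IsGenerating (mX := mX) G μ mT ∧ T = {B | MeasurableSet[mT] B}) :
    hAlg μ S dseq σ = hAlg μ T dseq σ ∧
    hAlg μ {B : Set X | MeasurableSet[mX] B} dseq σ = hAlg μ S dseq σ := by
  obtain ⟨mS, hSg, rfl⟩ := hS
  obtain ⟨mT, hTg, rfl⟩ := hT
  exact ⟨hAlg_eq (mX := mX) mS mT μ hact dseq σ hσ hSg hTg,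
    hAlg_eq (mX := mX) mX mS μ hact dseq σ hσ (generating_self (mX := mX) G μ) hSg⟩
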